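/- Let q and p be integers with q ≥ 1 and p ≥ q + 2. Then for every real polynomial μ of degree at most q, there exists a nonzero real polynomial v of degree at most p with v(0) = v(1) = 0 such that ∫₀¹ μ(x)·v(x) dx ≥ √(2/(q+3)) · ‖μ‖_{L²(0,1)} · ‖v‖_{L²(0,1)}, where ‖f‖_{L²(0,1)} = (∫₀¹ f(x)² dx)^{1/2}. -/

import Mathlib

open Polynomial in
/-- integral over the unit interval as a linear functional -/
noncomputable def II : ℝ[X] →ₗ[ℝ] ℝ where
  toFun f := ∫ x in (0:ℝ)..1, f.eval x
  map_add' f g := by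
    simp only [eval_add]
    exact intervalIntegral.integral_add (f.continuous.intervalIntegrable _ _)
      (g.continuous.intervalIntegrable _ _)
  map_smul' c f := by
    simp [eval_smul]

open Polynomial in
theorem II_apply (f : ℝ[X]) : II f = ∫ x in (0:ℝ)..1, f.eval x := rfl

open Polynomial in
theorem II_C_mul (c : ℝ) (f : ℝ[X]) : II (C c * f) = c * II f := by
  rw [← smul_eq_C_mul, map_smul, smul_eq_mul]

open Polynomial in
theorem II_deriv (f : ℝ[X]) : II (derivative f) = f.eval 1 - f.eval 0 := by
  rw [II_apply]
  exact intervalIntegral.integral_eq_sub_of_hasDerivAt (fun x _ => f.hasDerivAt x)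
    ((derivative f).continuous.intervalIntegrable _ _)

open Polynomial in
theorem II_sq_nonneg (f : ℝ[X]) : 0 ≤ II (f * f) := by
  rw [II_apply]
  apply intervalIntegral.integral_nonneg (by norm_num)
  intro x _
  rw [eval_mul]
  exact mul_self_nonneg _

open Polynomial in
theorem II_sq_pos (f : ℝ[X]) (hf : f ≠ 0) : 0 < II (f * f) := by
  rw [II_apply]
  have : ∃ c ∈ Set.Icc (0:ℝ) 1, f.eval c ≠ 0 := by
    by_contra! h
    apply hf
    apply Polynomial.eq_zero_of_infinite_isRoot
    exact (Set.Icc_infinite (zero_lt_one' ℝ)).mono (fun x hx => h x hx)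
  obtain ⟨c, hc, hc'⟩ := this
  refine intervalIntegral.integral_pos (by norm_num) (f * f).continuous.continuousOn ?_ ⟨c, hc, ?_⟩
  · intro x _
    rw [eval_mul]
    exact mul_self_nonneg _
  · rw [eval_mul]
    exact mul_self_pos.2 hc'

open Polynomial in
theorem II_orth (n : ℕ) (g : ℝ[X]) (h0 : ∀ j < n, (derivative^[j] g).eval 0 = 0)
    (h1 : ∀ j < n, (derivative^[j] g).eval 1 = 0) (f : ℝ[X]) (hf : f.degree < n) :
    II (f * derivative^[n] g) = 0 := by
  induction n generalizing f with
  | zero =>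
    have : f = 0 := by
      by_contra h
      have := zero_le_degree_iff.2 h
      exact absurd hf (not_lt.2 (by simpa using this))
    simp [this]
  | succ n ih =>
    have h := II_deriv (f * derivative^[n] g)
    rw [derivative_mul, map_add, eval_mul, eval_mul, h0 n (by lia), h1 n (by lia),
      ← Function.iterate_succ_apply' derivative n g,
      ih (fun j hj => h0 j (by lia)) (fun j hj => h1 j (by lia)) (derivative f) ?_] at h
    · linarith
    · by_cases hf0 : f = 0
      · simp [hf0]
      · have h2 := degree_derivative_lt hf0
        by_cases hd : derivative f = 0
        · rw [hd, degree_zero]; exact WithBot.bot_lt_coe _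
        rw [degree_eq_natDegree hf0] at hf h2
        rw [degree_eq_natDegree hd] at h2 ⊢
        norm_cast at *
        lia

open Polynomial in
/-- real shifted Legendre polynomial -/
noncomputable def LL (n : ℕ) : ℝ[X] := (shiftedLegendre n).map (Int.castRingHom ℝ)

open Polynomial in
theorem LL_degree (n : ℕ) : (LL n).degree = n := by
  rw [LL, degree_map_eq_of_injective (by exact Int.cast_injective), degree_shiftedLegendre]

open Polynomial in
theorem LL_zero (n : ℕ) : (LL n).eval 0 = 1 := by
  rw [← coeff_zero_eq_eval_zero, LL, coeff_map, coeff_shiftedLegendre]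
  simp

open Polynomial in
theorem LL_one (n : ℕ) : (LL n).eval 1 = (-1) ^ n := by
  have h := shiftedLegendre_eval_symm n (1:ℝ)
  have h0 := LL_zero n
  have e : ∀ x : ℝ, aeval x (shiftedLegendre n) = (LL n).eval x := by
    intro x
    rw [LL, eval_map, aeval_def]; rfl
  rw [e, e, sub_self, h0] at h
  rw [h, mul_one]

open Polynomial in
theorem LL_orth (n : ℕ) (f : ℝ[X]) (hf : f.degree < n) : II (f * LL n) = 0 := by
  have key : C (n.factorial : ℝ) * LL n = derivative^[n] (X ^ n * (1 - X) ^ n) := by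
    have h := congrArg (Polynomial.map (Int.castRingHom ℝ)) (factorial_mul_shiftedLegendre_eq n)
    rw [← iterate_derivative_map] at h
    simpa [LL] using h
  have h := II_orth n (X ^ n * (1 - X) ^ n) ?_ ?_ f hf
  · rw [← key, mul_left_comm, II_C_mul] at h
    have : (n.factorial : ℝ) ≠ 0 := by positivity
    simpa [this] using h
  · intro j hj
    obtain ⟨r, hr⟩ := (dvd_pow_self (X:ℝ[X]) (by lia : n - j ≠ 0)).trans
      (pow_sub_dvd_iterate_derivative_of_pow_dvd (q := (X:ℝ[X])) (n := n) j
      (dvd_mul_right (X ^ n) ((1 - X) ^ n)))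
    rw [hr]; simp
  · intro j hj
    obtain ⟨r, hr⟩ := (dvd_pow_self (1 - X:ℝ[X]) (by lia : n - j ≠ 0)).trans
      (pow_sub_dvd_iterate_derivative_of_pow_dvd (q := (1 - X:ℝ[X])) (n := n) j
      (dvd_mul_left ((1 - X) ^ n) (X ^ n)))
    rw [hr]; simp

open Polynomial in
theorem deg_lt_of {n : ℕ} {f : ℝ[X]} (h : f.degree ≤ n) (hc : f.coeff n = 0) : f.degree < n := by
  rw [degree_lt_iff_coeff_zero]
  intro m hm
  rcases eq_or_lt_of_le hm with rfl | hm
  · exact hc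
  · exact coeff_eq_zero_of_degree_lt (h.trans_lt (by exact_mod_cast hm))

open Polynomial in
theorem deg_C_mul_le' (c : ℝ) (f : ℝ[X]) : (C c * f).degree ≤ f.degree := by
  rw [← smul_eq_C_mul]
  exact degree_smul_le c f

open Polynomial in
theorem LL_norm (n : ℕ) : (2 * (n:ℝ) + 1) * II (LL n * LL n) = 1 := by
  have h := II_deriv (X * (LL n * LL n))
  have h2 : II ((X * derivative (LL n) - C (n:ℝ) * LL n) * LL n) = 0 := by
    apply LL_orth
    apply deg_lt_of
    · refine (degree_sub_le _ _).trans (max_le ?_ ?_)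
      · rw [degree_le_iff_coeff_zero]
        intro m hm
        cases m with
        | zero => simp
        | succ m =>
          rw [coeff_X_mul, coeff_derivative, coeff_eq_zero_of_degree_lt, zero_mul]
          rw [LL_degree]; exact hm
      · refine (deg_C_mul_le' _ _).trans (LL_degree n).le
    · cases n with
      | zero => simp
      | succ m =>
        rw [coeff_sub, coeff_X_mul, coeff_derivative, coeff_C_mul]
        push_cast; ring
  have e : derivative (X * (LL n * LL n)) = LL n * LL n +
      C 2 * ((X * derivative (LL n) - C (n:ℝ) * LL n) * LL n) + C (2 * (n:ℝ)) * (LL n * LL n) := by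
    simp only [derivative_mul, derivative_X, map_mul]
    have : (C 2 : ℝ[X]) = 2 := rfl
    rw [this]
    ring
  rw [e, map_add, map_add, II_C_mul, II_C_mul, h2] at h
  simp only [eval_mul, eval_X, LL_one] at h
  have : ((-1:ℝ)^n) * (-1)^n = 1 := by rw [← mul_pow]; norm_num
  rw [this] at h
  linarith

open Polynomial in
theorem eval_bound (e : ℝ) (he : ∀ k, ((LL k).eval e) ^ 2 = 1) (n : ℕ) (f : ℝ[X])
    (hf : f.degree < n) : (f.eval e) ^ 2 ≤ (n:ℝ) ^ 2 * II (f * f) := by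
  induction n generalizing f with
  | zero =>
    have : f = 0 := by
      by_contra h
      have := zero_le_degree_iff.2 h
      exact absurd hf (not_lt.2 (by simpa using this))
    simp [this]
  | succ n ih =>
    have hL : (LL n).coeff n ≠ 0 := by
      have := LL_degree n
      exact coeff_ne_zero_of_eq_degree this
    obtain ⟨c, hc⟩ : ∃ c, c = f.coeff n / (LL n).coeff n := ⟨_, rfl⟩
    obtain ⟨g, hg⟩ : ∃ g, g = f - C c * LL n := ⟨_, rfl⟩
    have hfn : f.degree ≤ n := by
      rw [degree_le_iff_coeff_zero]
      intro m hm
      refine coeff_eq_zero_of_degree_lt (hf.trans_le ?_)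
      norm_cast at *
    have hgd : g.degree < n := by
      apply deg_lt_of
      · rw [hg]
        exact (degree_sub_le _ _).trans (max_le hfn ((deg_C_mul_le' _ _).trans (LL_degree n).le))
      · rw [hg, coeff_sub, coeff_C_mul, hc, div_mul_cancel₀ _ hL, sub_self]
    have hfg : f = g + C c * LL n := by rw [hg]; ring
    have hN := LL_norm n
    have hO := LL_orth n g hgd
    have hI := ih g hgd
    have hE := he n
    have hP := II_sq_nonneg g
    have e2 : II (f * f) = II (g * g) + c ^ 2 * II (LL n * LL n) := by
      have : f * f = g * g + C (2 * c) * (g * LL n) + C (c ^ 2) * (LL n * LL n) := by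
        rw [hfg]
        have : (C 2 : ℝ[X]) = 2 := rfl
        simp only [map_mul, map_pow, this]
        ring
      rw [this, map_add, map_add, II_C_mul, II_C_mul, hO]
      ring
    have e3 : f.eval e = g.eval e + c * (LL n).eval e := by rw [hfg]; simp
    have hN' : II (LL n * LL n) = 1 / (2 * n + 1) := by
      rw [eq_div_iff (by positivity)]; linarith
    rw [e2, e3, hN']
    generalize g.eval e = y at *
    generalize II (g * g) = G at *
    have hdE : (c * (LL n).eval e) ^ 2 = c ^ 2 := by rw [mul_pow, hE, mul_one]
    generalize c * (LL n).eval e = d at *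
    rw [← hdE]
    push_cast
    rcases Nat.eq_zero_or_pos n with rfl | hn
    · simp at hI ⊢
      subst hI
      simp; nlinarith
    have hn' : (0:ℝ) < n := by exact_mod_cast hn
    have hG : y ^ 2 / n ^ 2 ≤ G := by
      rw [div_le_iff₀ (by positivity)]; linarith
    refine le_trans ?_ (mul_le_mul_of_nonneg_left (add_le_add_left hG _) (by positivity))
    rw [← sub_nonneg]
    have : ((n:ℝ) + 1) ^ 2 * (y ^ 2 / n ^ 2 + d ^ 2 * (1 / (2 * n + 1))) - (y + d) ^ 2
        = ((2 * n + 1) * y - n ^ 2 * d) ^ 2 / (n ^ 2 * (2 * n + 1)) := by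
      field_simp
      ring
    rw [this]
    positivity

/-- One-edge form of the local inf–sup condition (Theorem 4.1). -/
theorem local_inf_sup (q p : ℕ) (hq : 1 ≤ q) (hp : q + 2 ≤ p)
    (μ : Polynomial ℝ) (hμ : μ.natDegree ≤ q) :
    ∃ v : Polynomial ℝ, v ≠ 0 ∧ v.natDegree ≤ p ∧ v.eval 0 = 0 ∧ v.eval 1 = 0 ∧
      (∫ x in (0:ℝ)..1, μ.eval x * v.eval x)
        ≥ Real.sqrt (2/((q:ℝ)+3))
            * Real.sqrt (∫ x in (0:ℝ)..1, (μ.eval x)^2)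
            * Real.sqrt (∫ x in (0:ℝ)..1, (v.eval x)^2) := by
  open Polynomial in
  by_cases h0 : μ = 0
  · subst h0
    have hd : (X * (X - C 1) : ℝ[X]).natDegree = 2 := by
      rw [natDegree_mul X_ne_zero (X_sub_C_ne_zero 1), natDegree_X, natDegree_X_sub_C]
    refine ⟨X * (X - C 1), mul_ne_zero X_ne_zero (X_sub_C_ne_zero 1), by lia, by simp, by simp, ?_⟩
    simp
  have hA := II_sq_pos μ h0
  have hdeg : μ.degree < ((q + 1 : ℕ) : WithBot ℕ) := 
    (degree_le_of_natDegree_le hμ).trans_lt (by exact_mod_cast Nat.lt_succ_self q)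
  have hB0 := eval_bound 0 (fun k => by rw [LL_zero]; norm_num) (q + 1) μ hdeg
  have hB1 := eval_bound 1 (fun k => by rw [LL_one, ← pow_mul, mul_comm, pow_mul]; norm_num)
    (q + 1) μ hdeg
  have ho1 := LL_orth (q + 1) μ hdeg
  have ho2 := LL_orth (q + 2) μ (hdeg.trans (by exact_mod_cast Nat.lt_succ_self (q+1)))
  have ho3 := LL_orth (q + 2) (LL (q + 1)) (by
    rw [LL_degree]; exact_mod_cast Nat.lt_succ_self (q+1))
  have hn1 := LL_norm (q + 1)
  have hn2 := LL_norm (q + 2)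
  obtain ⟨s, hs⟩ : ∃ s : ℝ, s = (-1) ^ q := ⟨_, rfl⟩
  have hs2 : s ^ 2 = 1 := by rw [hs, ← pow_mul, mul_comm, pow_mul]; norm_num
  obtain ⟨a, ha⟩ : ∃ a : ℝ, a = -(μ.eval 0 - s * μ.eval 1) / 2 := ⟨_, rfl⟩
  obtain ⟨b, hb⟩ : ∃ b : ℝ, b = -(μ.eval 0 + s * μ.eval 1) / 2 := ⟨_, rfl⟩
  obtain ⟨v, hv⟩ : ∃ v : ℝ[X], v = μ + C a * LL (q + 1) + C b * LL (q + 2) := ⟨_, rfl⟩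
  have hab : a ^ 2 + b ^ 2 = ((μ.eval 0) ^ 2 + (μ.eval 1) ^ 2) / 2 := by
    rw [ha, hb]; linear_combination (μ.eval 1) ^ 2 / 2 * hs2
  have hμv : II (μ * v) = II (μ * μ) := by
    have : μ * v = μ * μ + C a * (μ * LL (q + 1)) + C b * (μ * LL (q + 2)) := by rw [hv]; ring
    rw [this, map_add, map_add, II_C_mul, II_C_mul, ho1, ho2]; ring
  have hvv : II (v * v) = II (μ * μ) + a ^ 2 * II (LL (q + 1) * LL (q + 1))
      + b ^ 2 * II (LL (q + 2) * LL (q + 2)) := by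
    have : v * v = μ * μ + C (a ^ 2) * (LL (q + 1) * LL (q + 1))
      + C (b ^ 2) * (LL (q + 2) * LL (q + 2)) + C (2 * a) * (μ * LL (q + 1))
      + C (2 * b) * (μ * LL (q + 2)) + C (2 * a * b) * (LL (q + 1) * LL (q + 2)) := by
      rw [hv]
      have : (C 2 : ℝ[X]) = 2 := rfl
      simp only [map_mul, map_pow, this]
      ring
    rw [this]
    simp only [map_add, II_C_mul, ho1, ho2, ho3]
    ring
  have hvle : II (v * v) ≤ ((q:ℝ) + 3) / 2 * II (μ * μ) := by
    push_cast at hn1 hn2 hB0 hB1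
    have hq0 : (0:ℝ) ≤ q := q.cast_nonneg
    have e1 : II (LL (q + 1) * LL (q + 1)) = 1 / (2 * q + 3) := by
      rw [eq_div_iff (by positivity)]; linarith
    have e2 : II (LL (q + 2) * LL (q + 2)) ≤ 1 / (2 * q + 3) := by
      rw [le_div_iff₀ (by positivity)]
      have := II_sq_nonneg (LL (q + 2))
      nlinarith
    have e3 : (a ^ 2 + b ^ 2) * (1 / (2 * q + 3)) ≤ ((q:ℝ) + 1) / 2 * II (μ * μ) := by
      rw [mul_one_div, div_le_iff₀ (by positivity)]
      nlinarith [mul_nonneg hq0 hA.le]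
    have e4 := mul_le_mul_of_nonneg_left e2 (sq_nonneg b)
    rw [hvv, e1]
    linarith
  refine ⟨v, ?_, ?_, ?_, ?_, ?_⟩
  · rintro h
    rw [h, mul_zero, map_zero] at hμv
    linarith
  · have hLn : ∀ k, (LL k).natDegree = k := fun k => natDegree_eq_of_degree_eq_some (LL_degree k)
    rw [hv]
    refine natDegree_add_le_of_degree_le (natDegree_add_le_of_degree_le (by lia) ?_) ?_
    · refine (natDegree_C_mul_le _ _).trans ?_
      rw [hLn]; lia
    · refine (natDegree_C_mul_le _ _).trans ?_
      rw [hLn]; lia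
  · rw [hv]
    simp only [eval_add, eval_mul, eval_C, LL_zero]
    rw [ha, hb]; ring
  · rw [hv]
    simp only [eval_add, eval_mul, eval_C, LL_one, pow_succ, ← hs]
    rw [ha, hb]; linear_combination -(μ.eval 1) * hs2
  · have i1 : (∫ x in (0:ℝ)..1, μ.eval x * v.eval x) = II (μ * μ) := by
      rw [← hμv, II_apply]; simp only [eval_mul]
    have i2 : ∀ f : ℝ[X], (∫ x in (0:ℝ)..1, (f.eval x) ^ 2) = II (f * f) := by
      intro f
      rw [II_apply]; simp only [eval_mul, pow_two]
    rw [i1, i2, i2, ge_iff_le, ← Real.sqrt_mul (by positivity), ← Real.sqrt_mul (by positivity)]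
    rw [Real.sqrt_le_left hA.le]
    calc 2 / ((q:ℝ) + 3) * II (μ * μ) * II (v * v)
        ≤ 2 / ((q:ℝ) + 3) * II (μ * μ) * (((q:ℝ) + 3) / 2 * II (μ * μ)) :=
          mul_le_mul_of_nonneg_left hvle (by positivity)
      _ = II (μ * μ) ^ 2 := by field_simp
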